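/- Let λ₋ < 2 < λ₊, let r > 0, define Λ(s) = λ₋ + (λ₊ − λ₋)(tanh(s) + 1)/2, let X_l(λ₋) denote the unique real root of 3x − x³ + λ₋ = 0 with x < −1, and let X_u(λ₊) denote the unique real root of 3x − x³ + λ₊ = 0 (which is greater than 2). If x : ℝ → ℝ is differentiable with x′(t) = 3x(t) − x(t)³ + Λ(rt) for all t and x(t) → X_l(λ₋) as t → −∞, then x(t) → X_u(λ₊) as t → +∞ (upstream B-tipping), for every r > 0. -/

import Mathlib

open Filter

lemma Real.tendsto_tanh_atTop_one : Tendsto Real.tanh atTop (nhds 1) := by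
  have h : Tendsto (fun t : ℝ => Real.exp (-(2 * t))) atTop (nhds 0) :=
    Real.tendsto_exp_neg_atTop_nhds_zero.comp (tendsto_id.const_mul_atTop two_pos)
  have h' := ((tendsto_const_nhds (x := (1 : ℝ))).sub h).div
    ((tendsto_const_nhds (x := (1 : ℝ))).add h) (by norm_num)
  rw [sub_zero, add_zero, div_one] at h'
  refine h'.congr fun t => ?_
  have e : Real.exp (-(2 * t)) = Real.exp (-t) * Real.exp (-t) := by
    rw [← Real.exp_add]; congr 1; ring
  have p : Real.exp t * Real.exp (-t) = 1 := by rw [← Real.exp_add]; simp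
  have a := Real.exp_pos t
  have b := Real.exp_pos (-t)
  simp only [Pi.div_apply]
  rw [Real.tanh_eq, e, div_eq_div_iff (by positivity) (by positivity)]
  linear_combination (-2 * Real.exp (-t)) * p

/-- A differential Gronwall argument: a nonnegative function that eventually satisfies
`v' ≤ c * (ε - v)`, for every `ε > 0`, tends to zero. -/
lemma tendsto_zero_of_eventually_deriv_le {c : ℝ} (hc : 0 < c) {v v' : ℝ → ℝ}
    (hv : ∀ t, HasDerivAt v (v' t) t) (hv0 : ∀ t, 0 ≤ v t)
    (h : ∀ ε > 0, ∀ᶠ t in atTop, v' t ≤ c * (ε - v t)) :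
    Tendsto v atTop (nhds 0) := by
  rw [tendsto_order]
  refine ⟨fun a ha => Eventually.of_forall fun t => ha.trans_le (hv0 t), fun a ha => ?_⟩
  obtain ⟨T, hT⟩ := eventually_atTop.1 (h (a / 2) (half_pos ha))
  set w : ℝ → ℝ := fun t => (v t - a / 2) * Real.exp (c * t) with hw_def
  have hw : ∀ t, HasDerivAt w ((v' t - c * (a / 2 - v t)) * Real.exp (c * t)) t := fun t =>
    (((hv t).sub_const (a / 2)).mul (hasDerivAt_const_mul c (x := t)).exp).congr_deriv (by ring)
  have hanti : AntitoneOn w (Set.Ici T) := by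
    refine antitoneOn_of_deriv_nonpos (convex_Ici T)
      (fun t _ => (hw t).continuousAt.continuousWithinAt)
      (fun t _ => (hw t).differentiableAt.differentiableWithinAt) fun t ht => ?_
    rw [interior_Ici] at ht
    rw [(hw t).deriv]
    exact mul_nonpos_of_nonpos_of_nonneg (sub_nonpos.2 (hT t (le_of_lt ht))) (Real.exp_pos _).le
  have hlim : Tendsto (fun t => w T * Real.exp (-(c * t))) atTop (nhds 0) := by
    simpa using (Real.tendsto_exp_neg_atTop_nhds_zero.comp
      (tendsto_id.const_mul_atTop hc)).const_mul (w T)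
  filter_upwards [hlim.eventually_lt_const (half_pos ha), eventually_ge_atTop T] with t ht hTt
  have hle := mul_le_mul_of_nonneg_right (hanti Set.self_mem_Ici hTt hTt)
    (Real.exp_pos (-(c * t))).le
  have hwt : w t * Real.exp (-(c * t)) = v t - a / 2 := by
    rw [hw_def]
    simp only
    rw [mul_assoc, ← Real.exp_add, add_neg_cancel, Real.exp_zero, mul_one]
  linarith

/-- Upstream B-tipping: for `λ₋ < 2 < λ₊` and any rate `r > 0`, the pullback trajectory
of `x′ = 3x − x³ + Λ(rt)` limiting to `X_l(λ₋)` in the past converges to the upper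
equilibrium `X_u(λ₊)` in the future. -/
theorem stmt_13 (lamm lamp : ℝ) (hm : lamm < 2) (hp : 2 < lamp) (r : ℝ) (hr : 0 < r)
    (Xlm : ℝ) (hXlm : Xlm < -1) (hXlmroot : 3 * Xlm - Xlm ^ 3 + lamm = 0)
    (Xup : ℝ) (hXup : Xup > 2) (hXuproot : 3 * Xup - Xup ^ 3 + lamp = 0)
    (hXupuniq : ∀ y : ℝ, 3 * y - y ^ 3 + lamp = 0 → y = Xup)
    (x : ℝ → ℝ)
    (hode : ∀ t : ℝ, HasDerivAt x
      (3 * x t - (x t) ^ 3 + (lamm + (lamp - lamm) * (Real.tanh (r * t) + 1) / 2)) t)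
    (hpast : Tendsto x atBot (nhds Xlm)) :
    Tendsto x atTop (nhds Xup) := by
  set g : ℝ → ℝ := fun t => (lamp - lamm) * (Real.tanh (r * t) - 1) / 2 with hg_def
  have hg : Tendsto g atTop (nhds 0) := by
    have h := Real.tendsto_tanh_atTop_one.comp (tendsto_id.const_mul_atTop hr)
    simpa [hg_def] using ((h.sub_const 1).const_mul (lamp - lamm)).div_const 2
  have hc : 0 < 3 * Xup ^ 2 / 4 - 3 := by nlinarith
  set c : ℝ := 3 * Xup ^ 2 / 4 - 3 with hc_def
  have hsq : Tendsto (fun t => (x t - Xup) ^ 2) atTop (nhds 0) := by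
    refine tendsto_zero_of_eventually_deriv_le hc
      (fun t => ((hode t).sub_const Xup).pow 2) (fun t => sq_nonneg _) fun ε hε => ?_
    have hg2 : Tendsto (fun t => g t ^ 2) atTop (nhds 0) := by simpa using hg.pow 2
    filter_upwards [hg2.eventually_lt_const (show 0 < c ^ 2 * ε by positivity)] with t ht
    set u := x t - Xup with hu
    have hfield : 3 * x t - x t ^ 3 + (lamm + (lamp - lamm) * (Real.tanh (r * t) + 1) / 2)
        = -(u * ((x t + Xup / 2) ^ 2 + c)) + g t := by
      simp only [hg_def, hc_def, hu]
      linear_combination hXuproot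
    have hyoung : 2 * u * g t ≤ c * u ^ 2 + c * ε := by
      refine le_of_mul_le_mul_left ?_ hc
      nlinarith [sq_nonneg (c * u - g t)]
    rw [hfield]
    norm_num
    nlinarith [mul_nonneg (sq_nonneg u) (sq_nonneg (x t + Xup / 2))]
  have habs : Tendsto (fun t => |x t - Xup|) atTop (nhds 0) := by
    simpa [Real.sqrt_sq_eq_abs] using hsq.sqrt
  simpa using ((tendsto_zero_iff_abs_tendsto_zero _).2 habs).add_const Xup
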